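/- Let Φ = {φ_j}_{j=1}^N be a nonlattice self-similar system on ℝ^m with attractor F and scaling vector r, and suppose Φ is δ-disjoint. Then there exists a sequence (Φ_M)_{M≥1} of lattice self-similar systems on ℝ^m, with scaling vectors r_M and attractors F_M, such that r_M → r componentwise, F_M → F in the Hausdorff metric, and for all sufficiently large M the system Φ_M is δ_M-disjoint for some δ_M > 0, with δ_M → δ as M → ∞. -/

import Mathlib

open Filter Topology Metric

/-- A scaling vector is *lattice* if its components are powers `ρ ^ (k j)` of a common
ratio `ρ ∈ (0,1)` with positive integer exponents whose gcd is `1`. -/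
def IsLatticeVec {N : ℕ} (r : Fin N → ℝ) : Prop :=
  ∃ (ρ : ℝ) (k : Fin N → ℕ), ρ ∈ Set.Ioo (0 : ℝ) 1 ∧ (∀ j, 0 < k j) ∧
    Finset.univ.gcd k = 1 ∧ ∀ j, r j = ρ ^ (k j)

/-- `φ` is a contracting similarity with scaling ratio `ρ`. -/
def IsSimilarity {X : Type*} [MetricSpace X] (φ : X → X) (ρ : ℝ) : Prop :=
  ∀ x y, dist (φ x) (φ y) = ρ * dist x y

/-- `F` is the attractor of the self-similar system `φ`. -/
def IsAttractor {X : Type*} [MetricSpace X] {N : ℕ} (φ : Fin N → X → X) (F : Set X) : Prop :=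
  F.Nonempty ∧ IsCompact F ∧ F = ⋃ j, φ j '' F

/-- The system `φ` with attractor `F` is `δ`-disjoint: `δ` is positive and is the supremum of
all `α > 0` such that distinct pieces `φ j '' F`, `φ k '' F` are at distance `> α` from each
other. -/
def IsDeltaDisjoint {X : Type*} [MetricSpace X] {N : ℕ} (φ : Fin N → X → X) (F : Set X)
    (δ : ℝ) : Prop :=
  0 < δ ∧ IsLUB {α : ℝ | 0 < α ∧ ∀ j k, j ≠ k →
    ∀ x ∈ φ j '' F, ∀ y ∈ φ k '' F, α < dist x y} δ

/-- Every vector with entries in `(0,1)` is a limit, from below, of lattice vectors. -/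
theorem exists_tendsto_isLatticeVec {N : ℕ} (hN : 0 < N) (r : Fin N → ℝ)
    (hr : ∀ j, r j ∈ Set.Ioo (0 : ℝ) 1) :
    ∃ R : ℕ → Fin N → ℝ, (∀ M j, R M j ∈ Set.Ioo (0 : ℝ) 1) ∧ (∀ M j, R M j ≤ r j) ∧
      (∀ M, IsLatticeVec (R M)) ∧ ∀ j, Tendsto (fun M => R M j) atTop (𝓝 (r j)) := by
  have hw : ∀ j, 0 < -Real.log (r j) := fun j => neg_pos.2 (Real.log_neg (hr j).1 (hr j).2)
  let k : ℕ → Fin N → ℕ := fun M j => ⌈-Real.log (r j) * ((M : ℝ) + 1)⌉₊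
  have hk : ∀ M j, 0 < k M j := fun M j =>
    Nat.ceil_pos.2 (mul_pos (hw j) (Nat.cast_add_one_pos M))
  refine ⟨fun M j => Real.exp (-((k M j : ℝ) / ((M : ℝ) + 1))), ?_, ?_, ?_, ?_⟩
  · intro M j
    have : 0 < (k M j : ℝ) := by exact_mod_cast hk M j
    exact ⟨Real.exp_pos _, Real.exp_lt_one_iff.2 (neg_neg_of_pos (by positivity))⟩
  · intro M j
    rw [← Real.le_log_iff_exp_le (hr j).1, neg_le, le_div_iff₀ (by positivity)]
    exact Nat.le_ceil _
  · intro M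
    obtain ⟨g, hg, hg1⟩ := Finset.extract_gcd (k M)
      (Finset.univ_nonempty_iff.2 ⟨(⟨0, hN⟩ : Fin N)⟩)
    set d := Finset.univ.gcd (k M)
    have hd0 : 0 < d := by
      rcases Nat.eq_zero_or_pos d with h | h
      · have h1 := hk M ⟨0, hN⟩
        rw [hg ⟨0, hN⟩ (Finset.mem_univ _), h, zero_mul] at h1
        exact absurd h1 (lt_irrefl 0)
      · exact h
    refine ⟨Real.exp (-((d : ℝ) / ((M : ℝ) + 1))), g, ⟨Real.exp_pos _, ?_⟩, ?_, hg1, ?_⟩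
    · have : 0 < (d : ℝ) := by exact_mod_cast hd0
      exact Real.exp_lt_one_iff.2 (neg_neg_of_pos (by positivity))
    · intro j
      have h1 := hk M j
      rw [hg j (Finset.mem_univ _)] at h1
      exact Nat.pos_of_mul_pos_left h1
    · intro j
      have h1 : (k M j : ℝ) = d * g j := by exact_mod_cast hg j (Finset.mem_univ _)
      dsimp only
      rw [← Real.exp_nat_mul, h1]
      congr 1
      ring
  · intro j
    have h1 : Tendsto (fun M : ℕ => (k M j : ℝ) / ((M : ℝ) + 1)) atTop
        (𝓝 (-Real.log (r j))) :=
      (tendsto_nat_ceil_mul_div_atTop (hw j).le).comp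
        (tendsto_atTop_add_const_right _ 1 tendsto_natCast_atTop_atTop)
    have h2 := (Real.continuous_exp.tendsto _).comp h1.neg
    simpa [Function.comp_def, Real.exp_log (hr j).1] using h2

theorem exists_dist_le_hausdorffDist {X : Type*} [MetricSpace X] {A B : Set X}
    (hA : IsCompact A) (hB : IsCompact B) (hA' : A.Nonempty) (hB' : B.Nonempty) {a : X}
    (ha : a ∈ A) : ∃ b ∈ B, dist a b ≤ hausdorffDist A B := by
  obtain ⟨b, hb, hab⟩ := hB.exists_infDist_eq_dist hB' a
  exact ⟨b, hb, hab ▸ infDist_le_hausdorffDist_of_mem ha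
    (hausdorffEDist_ne_top_of_nonempty_of_bounded hA' hB' hA.isBounded hB.isBounded)⟩

theorem IsSimilarity.continuous {X : Type*} [MetricSpace X] {φ : X → X} {ρ : ℝ}
    (h : IsSimilarity φ ρ) : Continuous φ :=
  (LipschitzWith.of_dist_le_mul (K := ρ.toNNReal) fun x y => by
    rw [h x y]
    exact mul_le_mul_of_nonneg_right (Real.le_coe_toNNReal ρ) dist_nonneg).continuous

/-- Collage theorem: a uniformly contracting system of similarities has an attractor, which is
close to any nonempty compact set that the system nearly fixes. -/
theorem exists_isAttractor_hausdorffDist_le {X : Type*} [MetricSpace X] [CompleteSpace X]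
    {N : ℕ} (hN : 0 < N) {φ : Fin N → X → X} {r : Fin N → ℝ} {K : ℝ} (hK0 : 0 ≤ K)
    (hK : K < 1) (hr : ∀ j, r j ≤ K) (hφ : ∀ j, IsSimilarity (φ j) (r j)) {A : Set X}
    (hA : IsCompact A) (hA' : A.Nonempty) {ε : ℝ}
    (hε : hausdorffDist A (⋃ j, φ j '' A) ≤ ε) :
    ∃ F, IsAttractor φ F ∧ hausdorffDist F A ≤ ε / (1 - K) := by
  let T : TopologicalSpace.NonemptyCompacts X → TopologicalSpace.NonemptyCompacts X := fun B =>
    { carrier := ⋃ j, φ j '' B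
      isCompact' := isCompact_iUnion fun j => B.isCompact.image (hφ j).continuous
      nonempty' := Set.nonempty_iUnion.2 ⟨⟨0, hN⟩, B.nonempty.image _⟩ }
  have key : ∀ B C : TopologicalSpace.NonemptyCompacts X, ∀ x ∈ (⋃ j, φ j '' (B : Set X)),
      ∃ y ∈ (⋃ j, φ j '' (C : Set X)), dist x y ≤ K * hausdorffDist (B : Set X) C := by
    intro B C x hx
    obtain ⟨j, b, hb, rfl⟩ := Set.mem_iUnion.1 hx
    obtain ⟨c, hc, hbc⟩ := exists_dist_le_hausdorffDist B.isCompact C.isCompact B.nonempty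
      C.nonempty hb
    refine ⟨φ j c, Set.mem_iUnion.2 ⟨j, c, hc, rfl⟩, ?_⟩
    rw [hφ j]
    exact mul_le_mul (hr j) hbc dist_nonneg hK0
  have hT : ContractingWith ⟨K, hK0⟩ T := by
    refine ⟨hK, LipschitzWith.of_dist_le_mul fun B C => ?_⟩
    rw [Metric.NonemptyCompacts.dist_eq, Metric.NonemptyCompacts.dist_eq]
    refine hausdorffDist_le_of_mem_dist (mul_nonneg hK0 hausdorffDist_nonneg) (key B C) ?_
    intro x hx
    obtain ⟨y, hy, hxy⟩ := key C B x hx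
    exact ⟨y, hy, by rwa [hausdorffDist_comm] at hxy⟩
  let A' : TopologicalSpace.NonemptyCompacts X := ⟨⟨A, hA⟩, hA'⟩
  have : Nonempty (TopologicalSpace.NonemptyCompacts X) := ⟨A'⟩
  refine ⟨(hT.fixedPoint T : TopologicalSpace.NonemptyCompacts X), ⟨TopologicalSpace.NonemptyCompacts.nonempty _,
    TopologicalSpace.NonemptyCompacts.isCompact _, ?_⟩, ?_⟩
  · exact congrArg (fun B : TopologicalSpace.NonemptyCompacts X => (B : Set X))
      (hT.fixedPoint_isFixedPt (f := T)).symm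
  · rw [hausdorffDist_comm]
    exact (hT.dist_fixedPoint_le A').trans
      (div_le_div_of_nonneg_right hε (sub_pos.2 hK).le)

/-- The distances between points of distinct pieces of a system. -/
def pieceDistances {X : Type*} [MetricSpace X] {N : ℕ} (φ : Fin N → X → X) (F : Set X) : Set ℝ :=
  {d | ∃ j k, j ≠ k ∧ ∃ x ∈ F, ∃ y ∈ F, d = dist (φ j x) (φ k y)}

theorem bddBelow_pieceDistances {X : Type*} [MetricSpace X] {N : ℕ} (φ : Fin N → X → X)
    (F : Set X) : BddBelow (pieceDistances φ F) :=
  ⟨0, by rintro _ ⟨j, k, -, x, -, y, -, rfl⟩; exact dist_nonneg⟩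

theorem pieceDistances_nonempty {X : Type*} [MetricSpace X] {N : ℕ} (hN : 2 ≤ N)
    (φ : Fin N → X → X) {F : Set X} (hF : F.Nonempty) : (pieceDistances φ F).Nonempty := by
  obtain ⟨x, hx⟩ := hF
  exact ⟨_, ⟨0, by omega⟩, ⟨1, by omega⟩, by simp, x, hx, x, hx, rfl⟩

theorem isDeltaDisjoint_sInf {X : Type*} [MetricSpace X] {N : ℕ} (hN : 2 ≤ N)
    {φ : Fin N → X → X} {F : Set X} (hF : F.Nonempty) (h : 0 < sInf (pieceDistances φ F)) :
    IsDeltaDisjoint φ F (sInf (pieceDistances φ F)) := by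
  refine ⟨h, ?_, ?_⟩
  · rintro α ⟨-, hα⟩
    refine le_csInf (pieceDistances_nonempty hN φ hF) ?_
    rintro _ ⟨j, k, hjk, x, hx, y, hy, rfl⟩
    exact (hα j k hjk _ ⟨x, hx, rfl⟩ _ ⟨y, hy, rfl⟩).le
  · intro b hb
    by_contra! hlt
    obtain ⟨α, hα, hα'⟩ := exists_between (max_lt h hlt)
    refine ((le_max_right _ _).trans_lt hα).not_ge (hb ⟨(le_max_left _ _).trans_lt hα, ?_⟩)
    rintro j k hjk _ ⟨x, hx, rfl⟩ _ ⟨y, hy, rfl⟩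
    exact hα'.trans_le
      (csInf_le (bddBelow_pieceDistances φ F) ⟨j, k, hjk, x, hx, y, hy, rfl⟩)

theorem IsDeltaDisjoint.eq_sInf {X : Type*} [MetricSpace X] {N : ℕ} (hN : 2 ≤ N)
    {φ : Fin N → X → X} {F : Set X} (hF : F.Nonempty) {δ : ℝ} (h : IsDeltaDisjoint φ F δ) :
    δ = sInf (pieceDistances φ F) := by
  have hle : δ ≤ sInf (pieceDistances φ F) := by
    refine le_csInf (pieceDistances_nonempty hN φ hF) ?_
    rintro _ ⟨j, k, hjk, x, hx, y, hy, rfl⟩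
    exact h.2.2 fun α hα => (hα.2 j k hjk _ ⟨x, hx, rfl⟩ _ ⟨y, hy, rfl⟩).le
  exact h.2.unique (isDeltaDisjoint_sInf hN hF (h.1.trans_le hle)).2

theorem sInf_pieceDistances_le {X : Type*} [MetricSpace X] {N : ℕ} (hN : 2 ≤ N)
    {φ ψ : Fin N → X → X} {F G : Set X} (hF : F.Nonempty) {η : ℝ}
    (h : ∀ x ∈ F, ∃ y ∈ G, ∀ j, dist (φ j x) (ψ j y) ≤ η) :
    sInf (pieceDistances ψ G) ≤ sInf (pieceDistances φ F) + 2 * η := by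
  rw [← sub_le_iff_le_add]
  refine le_csInf (pieceDistances_nonempty hN φ hF) ?_
  rintro _ ⟨j, k, hjk, x, hx, y, hy, rfl⟩
  obtain ⟨x', hx', hxx⟩ := h x hx
  obtain ⟨y', hy', hyy⟩ := h y hy
  have h1 := csInf_le (bddBelow_pieceDistances ψ G) ⟨j, k, hjk, x', hx', y', hy', rfl⟩
  have h2 := dist_triangle4 (ψ j x') (φ j x) (φ k y) (ψ k y')
  rw [dist_comm (ψ j x') (φ j x)] at h2
  linarith [hxx j, hyy k]

/-- A map rescaled about its value at the origin by the factor `t`. -/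
def rescaleMap {E : Type*} [NormedAddCommGroup E] [NormedSpace ℝ E] (φ : E → E) (t : ℝ) (x : E) :
    E :=
  φ 0 + t • (φ x - φ 0)

theorem IsSimilarity.rescaleMap {E : Type*} [NormedAddCommGroup E] [NormedSpace ℝ E] {φ : E → E}
    {ρ σ : ℝ} (h : IsSimilarity φ ρ) (hρ : 0 < ρ) (hσ : 0 ≤ σ) :
    IsSimilarity (rescaleMap φ (σ / ρ)) σ := by
  intro x y
  have := h x y
  rw [_root_.rescaleMap, _root_.rescaleMap, dist_add_left, dist_smul₀, dist_sub_right, this,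
    Real.norm_of_nonneg (by positivity)]
  field_simp

theorem IsSimilarity.dist_rescaleMap {E : Type*} [NormedAddCommGroup E] [NormedSpace ℝ E]
    {φ : E → E} {ρ : ℝ} (h : IsSimilarity φ ρ) (hρ : 0 < ρ) (σ : ℝ) (x : E) :
    dist (_root_.rescaleMap φ (σ / ρ) x) (φ x) = |σ - ρ| * ‖x‖ := by
  have h1 : _root_.rescaleMap φ (σ / ρ) x - φ x = (σ / ρ - 1) • (φ x - φ 0) := by
    rw [_root_.rescaleMap, sub_smul, one_smul]
    abel
  have h2 : ‖φ x - φ 0‖ = ρ * ‖x‖ := by rw [← dist_eq_norm, h x 0, dist_zero_right]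
  rw [dist_eq_norm, h1, norm_smul, h2, Real.norm_eq_abs, ← mul_assoc]
  congr 1
  rw [← abs_of_pos hρ, ← abs_mul, abs_of_pos hρ]
  congr 1
  field_simp

/-- A nonlattice `δ`-disjoint self-similar system on `ℝ^m` is approximated by lattice
self-similar systems: the scaling vectors converge componentwise, the attractors converge in
the Hausdorff metric, and eventually the approximating systems are `δ_M`-disjoint with
`δ_M → δ`. -/
theorem stmt2 {m N : ℕ} (hN : 2 ≤ N)
    (φ : Fin N → EuclideanSpace ℝ (Fin m) → EuclideanSpace ℝ (Fin m))
    (r : Fin N → ℝ) (hr : ∀ j, r j ∈ Set.Ioo (0 : ℝ) 1)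
    (hsim : ∀ j, IsSimilarity (φ j) (r j))
    (F : Set (EuclideanSpace ℝ (Fin m))) (hF : IsAttractor φ F)
    (hnl : ¬ IsLatticeVec r)
    (δ : ℝ) (hδ : IsDeltaDisjoint φ F δ) :
    ∃ (Φ : ℕ → Fin N → EuclideanSpace ℝ (Fin m) → EuclideanSpace ℝ (Fin m))
      (R : ℕ → Fin N → ℝ) (FM : ℕ → Set (EuclideanSpace ℝ (Fin m))) (δM : ℕ → ℝ),
      (∀ M j, R M j ∈ Set.Ioo (0 : ℝ) 1) ∧
      (∀ M j, IsSimilarity (Φ M j) (R M j)) ∧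
      (∀ M, IsLatticeVec (R M)) ∧
      (∀ M, IsAttractor (Φ M) (FM M)) ∧
      (∀ j, Tendsto (fun M => R M j) atTop (𝓝 (r j))) ∧
      Tendsto (fun M => hausdorffDist (FM M) F) atTop (𝓝 0) ∧
      (∀ᶠ M in atTop, 0 < δM M ∧ IsDeltaDisjoint (Φ M) (FM M) (δM M)) ∧
      Tendsto δM atTop (𝓝 δ) := by
  have hN0 : 0 < N := by omega
  obtain ⟨R, hR, hRr, hlat, hlim⟩ := exists_tendsto_isLatticeVec hN0 r hr
  obtain ⟨hFne, hFc, hFeq⟩ := hF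
  obtain ⟨C, hC0, hC⟩ := hFc.isBounded.exists_pos_norm_le
  obtain ⟨K, hK0, hK1, hK⟩ : ∃ K : ℝ, 0 ≤ K ∧ K < 1 ∧ ∀ j, r j ≤ K := by
    have : Nonempty (Fin N) := ⟨⟨0, hN0⟩⟩
    obtain ⟨i, hi⟩ := Finite.exists_max r
    exact ⟨r i, (hr i).1.le, (hr i).2, hi⟩
  let Φ : ℕ → Fin N → EuclideanSpace ℝ (Fin m) → EuclideanSpace ℝ (Fin m) := fun M j =>
    rescaleMap (φ j) (R M j / r j)
  have hΦ : ∀ M j, IsSimilarity (Φ M j) (R M j) := fun M j =>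
    (hsim j).rescaleMap (hr j).1 (hR M j).1.le
  let ε : ℕ → ℝ := fun M => (∑ j, |R M j - r j|) * C
  have hε0 : ∀ M, 0 ≤ ε M := fun M =>
    mul_nonneg (Finset.sum_nonneg fun _ _ => abs_nonneg _) hC0.le
  have hε : Tendsto ε atTop (𝓝 0) := by
    have h1 : Tendsto (fun M => ∑ j, |R M j - r j|) atTop (𝓝 (∑ _j : Fin N, (0 : ℝ))) :=
      tendsto_finsetSum _ fun j _ => by
        simpa using ((hlim j).sub_const (r j)).abs
    simpa using h1.mul_const C
  have hclose : ∀ M j, ∀ x ∈ F, dist (Φ M j x) (φ j x) ≤ ε M := by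
    intro M j x hx
    rw [(hsim j).dist_rescaleMap (hr j).1]
    exact mul_le_mul
      (Finset.single_le_sum (f := fun i => |R M i - r i|) (fun _ _ => abs_nonneg _)
        (Finset.mem_univ j)) (hC x hx) (norm_nonneg _)
      (Finset.sum_nonneg fun _ _ => abs_nonneg _)
  have hcollage : ∀ M, hausdorffDist F (⋃ j, Φ M j '' F) ≤ ε M := by
    intro M
    refine hausdorffDist_le_of_mem_dist (hε0 M) ?_ ?_
    · intro x hx
      rw [hFeq] at hx
      obtain ⟨j, y, hy, rfl⟩ := Set.mem_iUnion.1 hx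
      exact ⟨Φ M j y, Set.mem_iUnion.2 ⟨j, y, hy, rfl⟩, by
        rw [dist_comm]; exact hclose M j y hy⟩
    · intro x hx
      obtain ⟨j, y, hy, rfl⟩ := Set.mem_iUnion.1 hx
      exact ⟨φ j y, by rw [hFeq]; exact Set.mem_iUnion.2 ⟨j, y, hy, rfl⟩, hclose M j y hy⟩
  choose FM hFM hFMdist using fun M => exists_isAttractor_hausdorffDist_le hN0 hK0 hK1
    (fun j => (hRr M j).trans (hK j)) (hΦ M) hFc hFne (hcollage M)
  have hη : Tendsto (fun M => hausdorffDist (FM M) F) atTop (𝓝 0) :=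
    squeeze_zero (fun _ => hausdorffDist_nonneg) hFMdist (by simpa using hε.div_const (1 - K))
  have hstep : ∀ M j, ∀ x, ∀ y ∈ F, dist x y ≤ hausdorffDist (FM M) F →
      dist (Φ M j x) (φ j y) ≤ hausdorffDist (FM M) F + ε M := by
    intro M j x y hy hxy
    refine (dist_triangle _ (Φ M j y) _).trans (add_le_add ?_ (hclose M j y hy))
    rw [hΦ M j]
    exact (mul_le_of_le_one_left dist_nonneg (hR M j).2.le).trans hxy
  have hlower : ∀ M, sInf (pieceDistances φ F) - 2 * (hausdorffDist (FM M) F + ε M) ≤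
      sInf (pieceDistances (Φ M) (FM M)) := by
    intro M
    rw [sub_le_iff_le_add]
    refine sInf_pieceDistances_le hN (hFM M).1 fun x hx => ?_
    obtain ⟨y, hy, hxy⟩ := exists_dist_le_hausdorffDist (hFM M).2.1 hFc (hFM M).1 hFne hx
    exact ⟨y, hy, fun j => hstep M j x y hy hxy⟩
  have hupper : ∀ M, sInf (pieceDistances (Φ M) (FM M)) ≤
      sInf (pieceDistances φ F) + 2 * (hausdorffDist (FM M) F + ε M) := by
    intro M
    refine sInf_pieceDistances_le hN hFne fun y hy => ?_
    obtain ⟨x, hx, hyx⟩ := exists_dist_le_hausdorffDist hFc (hFM M).2.1 hFne (hFM M).1 hy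
    refine ⟨x, hx, fun j => ?_⟩
    rw [dist_comm]
    rw [dist_comm, hausdorffDist_comm] at hyx
    exact hstep M j x y hy hyx
  have hδlim : Tendsto (fun M => sInf (pieceDistances (Φ M) (FM M))) atTop (𝓝 δ) := by
    rw [hδ.eq_sInf hN hFne]
    have h0 := (hη.add hε).const_mul 2
    refine tendsto_of_tendsto_of_tendsto_of_le_of_le ?_ ?_ hlower hupper
    · simpa using h0.const_sub (sInf (pieceDistances φ F))
    · simpa using h0.const_add (sInf (pieceDistances φ F))
  refine ⟨Φ, R, FM, fun M => sInf (pieceDistances (Φ M) (FM M)), hR, hΦ, hlat, hFM, hlim, hη,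
    ?_, hδlim⟩
  filter_upwards [hδlim.eventually_const_lt hδ.1] with M hM
  exact ⟨hM, isDeltaDisjoint_sInf hN (hFM M).1 hM⟩
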